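/- Let q be an odd prime power, n = (q^m+1)/2, and let β be a primitive (q^m+1)-th root of unity in GF(q^{2m}). Let δ be an integer with 2 ≤ δ ≤ (q^{m/2}+3)/2 if m ≥ 4 is even, and 2 ≤ δ ≤ (q^{(m+1)/2}−q+2)/2 if m ≥ 3 is odd. Then the negacyclic BCH code C_{(q,n,δ,0)} has generator polynomial g(x) = ∏ M_{β^{1+2i}}(x), the product over those i with 0 ≤ i ≤ δ−2 and i ≢ (q−1)/2 (mod q); its dimension is n − 2m·⌈(2δ−3)(q−1)/(2q)⌉; and its minimum distance d satisfies d ≥ 2δ+1 if δ ≡ (q+1)/2 (mod q) and d ≥ 2δ−1 otherwise. -/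

import Mathlib

open Polynomial

/-- Every nonzero codeword of the negacyclic code of length `n` over `F` with
generator polynomial `g` has Hamming weight at least `d` (i.e. the minimum
distance is at least `d`). -/
def MinDistLB {F : Type*} [Field F] (g : Polynomial F) (n d : ℕ) : Prop :=
  ∀ c : Polynomial F, c ≠ 0 → g ∣ c → c.natDegree < n → d ≤ c.support.card

section NumberTheory

lemma eq_zero_and_eq_of_cast_pow_sub_eq_zero {q M h L j s t : ℕ} (hL : L * (q ^ h + 1) ≤ M)
    (hj : j ≤ h) (hq : 0 < q) (hsL : s ≤ L) (htL : t ≤ L) (ht : ¬ q ∣ t)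
    (hd : ((M : ℤ) + 1) ∣ (s : ℤ) * (q : ℤ) ^ j - t) : j = 0 ∧ s = t := by
  have hle : s * q ^ j ≤ L * q ^ h := Nat.mul_le_mul hsL (Nat.pow_le_pow_right hq hj)
  have h0 : (s : ℤ) * (q : ℤ) ^ j - t = 0 := by
    apply Int.eq_zero_of_abs_lt_dvd hd
    have h1 : (s : ℤ) * (q : ℤ) ^ j ≤ L * (q : ℤ) ^ h := by exact_mod_cast hle
    have h2 : (L : ℤ) * ((q : ℤ) ^ h + 1) ≤ M := by exact_mod_cast hL
    have h3 : (0 : ℤ) ≤ (s : ℤ) * (q : ℤ) ^ j := by positivity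
    have h4 : (t : ℤ) ≤ L := by exact_mod_cast htL
    have h5 : (0 : ℤ) ≤ (L : ℤ) * (q : ℤ) ^ h := by positivity
    rw [abs_lt]
    constructor <;> linarith [Int.natCast_nonneg t]
  have h1 : s * q ^ j = t := by exact_mod_cast sub_eq_zero.mp h0
  rcases Nat.eq_zero_or_pos j with rfl | hjpos
  · exact ⟨rfl, by simpa using h1⟩
  · exact absurd (h1 ▸ (dvd_pow_self q hjpos.ne').mul_left s) ht

lemma not_dvd_mul_pow_add {q M h L j s t : ℕ} (hL : L * (q ^ h + 1) ≤ M)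
    (hj : j ≤ h) (hq : 0 < q) (hsL : s ≤ L) (htL : t ≤ L) (ht : 0 < t) :
    ¬ ((M : ℤ) + 1) ∣ (s : ℤ) * (q : ℤ) ^ j + t := by
  intro hd
  have hle : s * q ^ j ≤ L * q ^ h := Nat.mul_le_mul hsL (Nat.pow_le_pow_right hq hj)
  have hd' : M + 1 ∣ s * q ^ j + t := by exact_mod_cast hd
  have := Nat.le_of_dvd (by positivity) hd'
  linarith

/-- Small integers prime to the base lie in distinct full-size `q`-cyclotomic cosets modulo
`q ^ m + 1`. -/
lemma eq_zero_and_eq_of_cyclotomic_coset {q m h L k s t : ℕ} (hL : L * (q ^ h + 1) ≤ q ^ m)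
    (hm : m ≤ 2 * h + 1) (hq : 0 < q) (hsL : s ≤ L) (htL : t ≤ L) (hs : ¬ q ∣ s)
    (ht : ¬ q ∣ t) (hk : k < 2 * m)
    (hd : ((q ^ m : ℕ) + 1 : ℤ) ∣ (s : ℤ) * (q : ℤ) ^ k - t) : k = 0 ∧ s = t := by
  have hs0 : 0 < s := Nat.pos_of_ne_zero fun h => hs (h ▸ dvd_zero q)
  have ht0 : 0 < t := Nat.pos_of_ne_zero fun h => ht (h ▸ dvd_zero q)
  have hN : ((q ^ m : ℕ) + 1 : ℤ) ∣ (q : ℤ) ^ m + 1 := by push_cast; exact dvd_rfl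
  rcases le_or_gt k h with hkh | hkh
  · exact eq_zero_and_eq_of_cast_pow_sub_eq_zero hL hkh hq hsL htL ht hd
  rcases le_or_gt k m with hkm | hkm
  · exfalso
    refine not_dvd_mul_pow_add hL (j := m - k) (by omega) hq htL hsL hs0 ?_
    have e : (t : ℤ) * (q : ℤ) ^ (m - k) + s =
        s * ((q : ℤ) ^ m + 1) - ((s : ℤ) * (q : ℤ) ^ k - t) * (q : ℤ) ^ (m - k) := by
      have : (q : ℤ) ^ k * (q : ℤ) ^ (m - k) = (q : ℤ) ^ m := by
        rw [← pow_add]; congr 1; omega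
      linear_combination (s : ℤ) * this
    rw [e]
    exact dvd_sub (hN.mul_left _) (hd.mul_right _)
  rcases le_or_gt k (m + h) with hkmh | hkmh
  · exfalso
    refine not_dvd_mul_pow_add hL (j := k - m) (by omega) hq hsL htL ht0 ?_
    have e : (s : ℤ) * (q : ℤ) ^ (k - m) + t =
        s * (q : ℤ) ^ (k - m) * ((q : ℤ) ^ m + 1) - ((s : ℤ) * (q : ℤ) ^ k - t) := by
      have : (q : ℤ) ^ (k - m) * (q : ℤ) ^ m = (q : ℤ) ^ k := by
        rw [← pow_add]; congr 1; omega
      linear_combination -(s : ℤ) * this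
    rw [e]
    exact dvd_sub (hN.mul_left _) hd
  · have e : (t : ℤ) * (q : ℤ) ^ (2 * m - k) - s =
        s * ((q : ℤ) ^ m - 1) * ((q : ℤ) ^ m + 1)
          - ((s : ℤ) * (q : ℤ) ^ k - t) * (q : ℤ) ^ (2 * m - k) := by
      have : (q : ℤ) ^ k * (q : ℤ) ^ (2 * m - k) = (q : ℤ) ^ m * (q : ℤ) ^ m := by
        rw [← pow_add, ← pow_add]; congr 1; omega
      linear_combination (s : ℤ) * this
    have := eq_zero_and_eq_of_cast_pow_sub_eq_zero hL (j := 2 * m - k) (by omega) hq htL hsL hs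
      (by rw [e]; exact dvd_sub (hN.mul_left _) (hd.mul_right _))
    omega

lemma card_filter_range_not_mod (r K : ℕ) :
    ((Finset.range K).filter (fun i => ¬ i % (2 * r + 1) = r)).card +
      (K + r) / (2 * r + 1) = K := by
  induction K with
  | zero => simp; omega
  | succ K ih =>
    have hiff : 2 * r + 1 ∣ K + r + 1 ↔ K % (2 * r + 1) = r := by
      have h1 := Nat.div_add_mod K (2 * r + 1)
      have h2 := Nat.mod_lt K (show 2 * r + 1 > 0 by omega)
      have e : K + r + 1 = (2 * r + 1) * (K / (2 * r + 1)) + (K % (2 * r + 1) + r + 1) := by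
        omega
      rw [e, Nat.dvd_add_right (dvd_mul_right _ _)]
      constructor
      · rintro ⟨c, hc⟩
        have : c = 1 := by
          rcases c with _ | _ | c
          · omega
          · rfl
          · nlinarith
        subst this; omega
      · intro h
        exact ⟨1, by omega⟩
    rw [Finset.range_add_one, Finset.filter_insert, show K + 1 + r = K + r + 1 by ring,
      Nat.succ_div]
    by_cases h : K % (2 * r + 1) = r
    · rw [if_neg (by simpa using h), if_pos (hiff.mpr h)]
      omega
    · rw [if_pos h, if_neg (fun h' => h (hiff.mp h')), Finset.card_insert_of_notMem (by simp)]
      omega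

lemma card_filter_range_not_mod_eq_ceil (r K : ℕ) :
    ((Finset.range K).filter (fun i => ¬ i % (2 * r + 1) = r)).card =
      (2 * r * (2 * K) + (2 * r + 1)) / (2 * (2 * r + 1)) := by
  have h := card_filter_range_not_mod r K
  set c := ((Finset.range K).filter (fun i => ¬ i % (2 * r + 1) = r)).card
  set d := (K + r) / (2 * r + 1) with hd
  have h1 : (2 * r + 1) * d ≤ K + r := Nat.mul_div_le _ _
  have h2 : K + r < (2 * r + 1) * (d + 1) := Nat.lt_mul_div_succ _ (by omega)
  symm
  rw [Nat.div_eq_iff (by omega)]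
  constructor
  · nlinarith
  · have : 2 * r * (2 * K) + (2 * r + 1) < (c + 1) * (2 * (2 * r + 1)) := by nlinarith
    have e : (c + 1) * (2 * (2 * r + 1)) = c * (2 * (2 * r + 1)) + 2 * (2 * r + 1) := by ring
    omega

end NumberTheory

section FiniteField

variable {F E : Type*} [Field F] [Fintype F] [Field E] [Algebra F E]

lemma aeval_pow_card_eq (x : E) (f : F[X]) :
    aeval (x ^ Fintype.card F) f = aeval x f ^ Fintype.card F := by
  rw [← expand_aeval, FiniteField.expand_card, map_pow]

lemma aeval_pow_card_pow_eq_zero {x : E} {f : F[X]} (h : aeval x f = 0) (k : ℕ) :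
    aeval (x ^ Fintype.card F ^ k) f = 0 := by
  induction k with
  | zero => simpa using h
  | succ k ih =>
    rw [pow_succ, pow_mul, aeval_pow_card_eq, ih, zero_pow Fintype.card_ne_zero]

lemma minpoly_pow_card [Finite E] (x : E) : minpoly F (x ^ Fintype.card F) = minpoly F x := by
  have hx : IsIntegral F x := IsIntegral.of_finite F x
  refine (minpoly.eq_of_irreducible_of_monic (minpoly.irreducible hx) ?_ (minpoly.monic hx)).symm
  rw [aeval_pow_card_eq, minpoly.aeval, zero_pow Fintype.card_ne_zero]

lemma pow_card_pow_natDegree_minpoly [Finite E] (x : E) :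
    x ^ Fintype.card F ^ (minpoly F x).natDegree = x := by
  have hx : IsIntegral F x := IsIntegral.of_finite F x
  have : Fintype (IntermediateField.adjoin F {x}) := Fintype.ofFinite _
  have h := FiniteField.pow_card (IntermediateField.AdjoinSimple.gen F x)
  rw [Module.card_eq_pow_finrank (K := F), IntermediateField.adjoin.finrank hx] at h
  simpa using congrArg (algebraMap (IntermediateField.adjoin F {x}) E) h

lemma exists_pow_card_pow_eq_of_minpoly_eq [Finite E] {x y : E}
    (h : minpoly F x = minpoly F y) :
    ∃ k < Module.finrank F E, x ^ Fintype.card F ^ k = y := by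
  obtain ⟨σ, hσ⟩ := (Normal.minpoly_eq_iff_mem_orbit E).mp h.symm
  obtain ⟨k, hk⟩ := (FiniteField.bijective_frobeniusAlgEquivOfAlgebraic_pow F E).2 σ
  refine ⟨k, k.2, ?_⟩
  rw [← hσ, ← hk]
  simp [AlgEquiv.smul_def, FiniteField.coe_frobeniusAlgEquivOfAlgebraic_iterate, AlgEquiv.coe_pow]

end FiniteField

section BCH

variable {K : Type*} [Field K]

/-- The BCH bound: a nonzero polynomial of degree less than `n` vanishing on a geometric
progression of length `W`, with ratio a primitive `n`-th root of unity, has more than `W`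
nonzero coefficients. -/
lemma lt_card_support_of_eval_geometric {n W : ℕ} {α γ : K} (hα : IsPrimitiveRoot α n)
    (hγ : γ ≠ 0) {c : K[X]} (hc : c ≠ 0) (hdeg : c.natDegree < n)
    (hroot : ∀ j < W, c.eval (γ * α ^ j) = 0) : W < c.support.card := by
  by_contra! hW
  let e := c.support.equivFin.symm
  have hzero : (fun i => c.coeff (e i) * γ ^ (e i : ℕ)) = 0 := by
    refine Matrix.eq_zero_of_forall_pow_sum_mul_pow_eq_zero
      (f := fun i => α ^ (e i : ℕ)) ?_ ?_
    · intro i j hij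
      have hlt : ∀ i, (e i : ℕ) < n := fun i =>
        (le_natDegree_of_mem_supp _ (e i).2).trans_lt hdeg
      exact e.injective (Subtype.ext (hα.pow_inj (hlt i) (hlt j) hij))
    · intro j
      have h := hroot j (j.2.trans_le hW)
      rw [eval_eq_sum, Polynomial.sum, ← Finset.sum_coe_sort, ← e.sum_comp] at h
      rw [← h]
      refine Finset.sum_congr rfl fun i _ => ?_
      rw [mul_pow, ← pow_mul, ← pow_mul, mul_comm (e i : ℕ) (j : ℕ), mul_assoc]
  obtain ⟨k, hk⟩ := nonempty_support_iff.mpr hc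
  have := congrFun hzero (c.support.equivFin ⟨k, hk⟩)
  simp [e, hγ] at this
  exact mem_support_iff.mp hk this

end BCH

section Negacyclic

variable {F E : Type*} [Field F] [Fintype F] [Field E] [Algebra F E]

lemma IsPrimitiveRoot.dvd_mul_pow_sub {N q k s t : ℕ} {β : E} (hβ : IsPrimitiveRoot β N)
    (hN : 0 < N) (h : (β ^ s) ^ q ^ k = β ^ t) : (N : ℤ) ∣ (s : ℤ) * (q : ℤ) ^ k - t := by
  rw [← hβ.zpow_eq_one_iff_dvd, zpow_sub₀ (hβ.ne_zero hN.ne')]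
  have e : (s : ℤ) * (q : ℤ) ^ k = ((s * q ^ k : ℕ) : ℤ) := by push_cast; rfl
  rw [e, zpow_natCast, zpow_natCast, pow_mul, h, div_self (pow_ne_zero _ (hβ.ne_zero hN.ne'))]

/-- Vanishing at the first `T` odd powers of a primitive `(q ^ m + 1)`-th root of unity forces
more than `2 * T` nonzero coefficients. -/
lemma lt_card_support_of_aeval_odd_pow {m n T : ℕ} {β : E}
    (hβ : IsPrimitiveRoot β (Fintype.card F ^ m + 1)) (hn : Fintype.card F ^ m + 1 = 2 * n)
    {c : F[X]} (hc : c ≠ 0) (hdeg : c.natDegree < n)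
    (hroot : ∀ i < T, aeval (β ^ (1 + 2 * i)) c = 0) : 2 * T < c.support.card := by
  have hβ0 : β ≠ 0 := hβ.ne_zero (by omega)
  have hα : IsPrimitiveRoot (β ^ 2) n := hβ.pow (by omega) hn
  have hinv : ∀ i < T, aeval (β ^ (1 + 2 * i))⁻¹ c = 0 := by
    intro i hi
    have h := aeval_pow_card_pow_eq_zero (hroot i hi) m
    convert h using 3
    refine inv_eq_of_mul_eq_one_right ?_
    rw [← pow_succ', ← pow_mul,
      mul_comm, pow_mul, hβ.pow_eq_one, one_pow]
  have h := lt_card_support_of_eval_geometric (W := 2 * T) (γ := (β ^ (2 * T))⁻¹ * β) hα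
    (mul_ne_zero (inv_ne_zero (pow_ne_zero _ hβ0)) hβ0)
    (c := c.map (algebraMap F E)) (map_ne_zero hc) (by rwa [natDegree_map]) ?_
  · rwa [support_map_of_injective _ (algebraMap F E).injective] at h
  · intro j hj
    rw [eval_map_algebraMap]
    rcases lt_or_ge j T with hjT | hjT
    · convert hinv (T - 1 - j) (by omega) using 3
      rw [show 2 * T = (1 + 2 * (T - 1 - j)) + (1 + 2 * j) by omega, pow_add]
      field_simp
      ring
    · obtain ⟨i, rfl⟩ := Nat.exists_eq_add_of_le hjT
      convert hroot i (by omega) using 3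
      field_simp
      ring

end Negacyclic

theorem stmt10 (q m : ℕ) (hq : Odd q) (hpp : IsPrimePow q)
    (F E : Type) [Field F] [Fintype F] [DecidableEq F] [Field E] [Fintype E] [Algebra F E]
    (hF : Fintype.card F = q) (hE : Fintype.card E = q ^ (2 * m))
    (n : ℕ) (hn : n = (q ^ m + 1) / 2)
    (β : E) (hβ : IsPrimitiveRoot β (q ^ m + 1))
    (δ : ℕ) (hδ2 : 2 ≤ δ)
    (hδ : (Even m ∧ 4 ≤ m ∧ δ ≤ (q ^ (m / 2) + 3) / 2) ∨
          (Odd m ∧ 3 ≤ m ∧ δ ≤ (q ^ ((m + 1) / 2) - q + 2) / 2))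
    (g : Polynomial F)
    (hg : g = Finset.lcm (Finset.range (δ - 1)) (fun i => minpoly F (β ^ (1 + 2 * i)))) :
    g = ∏ i ∈ (Finset.range (δ - 1)).filter (fun i => ¬ i % q = (q - 1) / 2),
          minpoly F (β ^ (1 + 2 * i)) ∧
    g.natDegree = 2 * m * (((2 * δ - 3) * (q - 1) + (2 * q - 1)) / (2 * q)) ∧
    MinDistLB g n (if δ % q = (q + 1) / 2 then 2 * δ + 1 else 2 * δ - 1) := by
  subst hF
  set q := Fintype.card F with hqdef
  obtain ⟨r, hr⟩ := hq
  have hq1 : 1 < q := hpp.one_lt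
  have hq0 : 0 < q := by omega
  have hn2 : q ^ m + 1 = 2 * n := by
    obtain ⟨k, hk⟩ : Odd (q ^ m) := Odd.pow ⟨r, hr⟩
    omega
  have hfin : Module.finrank F E = 2 * m := by
    have h := Module.card_eq_pow_finrank (K := F) (V := E)
    rw [hE] at h
    exact (Nat.pow_right_injective hq1 h).symm
  have hint : ∀ x : E, IsIntegral F x := fun x => IsIntegral.of_finite F x
  have hdvd_iff : ∀ i, q ∣ 1 + 2 * i ↔ i % q = (q - 1) / 2 := by
    intro i
    have h1 := Nat.div_add_mod i q
    have h2 := Nat.mod_lt i hq0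
    have e : 1 + 2 * i = q * (2 * (i / q)) + (1 + 2 * (i % q)) := by
      have : q * (2 * (i / q)) = 2 * (q * (i / q)) := by ring
      omega
    rw [e, Nat.dvd_add_right (dvd_mul_right _ _)]
    constructor
    · rintro ⟨c, hc⟩
      have : c = 1 := by
        rcases c with _ | _ | c
        · omega
        · rfl
        · nlinarith
      subst this; omega
    · intro h
      exact ⟨1, by omega⟩
  obtain ⟨h, L, hL, hm, hbound⟩ : ∃ h L : ℕ, L * (q ^ h + 1) ≤ q ^ m ∧ m ≤ 2 * h + 1 ∧
      ∀ i < δ - 1, ¬ q ∣ 1 + 2 * i → 1 + 2 * i ≤ L := by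
    rcases hδ with ⟨⟨h, hh⟩, hm4, hle⟩ | ⟨⟨h, hh⟩, hm3, hle⟩
    · rw [show m / 2 = h by omega] at hle
      refine ⟨h, q ^ h - 1, ?_, by omega, ?_⟩
      · rw [hh, pow_add]
        have : 1 ≤ q ^ h := Nat.one_le_pow _ _ hq0
        obtain ⟨a, ha⟩ := Nat.exists_eq_add_of_le this
        rw [ha, Nat.add_sub_cancel_left]
        nlinarith
      · intro i hi hqi
        have : 1 + 2 * i ≠ q ^ h := fun heq => hqi (heq ▸ dvd_pow_self q (by omega))
        omega
    · rw [show (m + 1) / 2 = h + 1 by omega] at hle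
      have hqq : q ≤ q ^ (h + 1) := Nat.le_self_pow (by omega) q
      refine ⟨h, q ^ (h + 1) - q - 1, ?_, by omega, ?_⟩
      · have e : q ^ m = q ^ (h + 1) * q ^ h := by rw [← pow_add]; congr 1; omega
        rw [e]
        rcases Nat.lt_or_ge (q ^ (h + 1)) (q + 1) with hlt | hge
        · rw [show q ^ (h + 1) - q - 1 = 0 by omega]
          simp
        · obtain ⟨a, ha⟩ := Nat.exists_eq_add_of_le hge
          have : q ^ (h + 1) - q - 1 = a := by omega
          rw [this]
          have e2 : q ^ (h + 1) = q ^ h * q := pow_succ q h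
          nlinarith
      · intro i hi hqi
        omega
  have hcoset : ∀ i < δ - 1, ¬ q ∣ 1 + 2 * i → ∀ j < δ - 1, ¬ q ∣ 1 + 2 * j → ∀ k < 2 * m,
      (β ^ (1 + 2 * i)) ^ q ^ k = β ^ (1 + 2 * j) → k = 0 ∧ i = j := by
    intro i hi hqi j hj hqj k hk he
    have hd := hβ.dvd_mul_pow_sub (by omega) he
    have := eq_zero_and_eq_of_cyclotomic_coset hL hm hq0 (hbound i hi hqi) (hbound j hj hqj)
      hqi hqj hk (by exact_mod_cast hd)
    omega
  set S := (Finset.range (δ - 1)).filter (fun i => ¬ i % q = (q - 1) / 2) with hS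
  have hSmem : ∀ {i}, i ∈ S ↔ i < δ - 1 ∧ ¬ q ∣ 1 + 2 * i := by
    intro i
    rw [hS, Finset.mem_filter, Finset.mem_range, hdvd_iff]
  have hdegree : ∀ i ∈ S, (minpoly F (β ^ (1 + 2 * i))).natDegree = 2 * m := by
    intro i hi
    obtain ⟨hi, hqi⟩ := hSmem.mp hi
    by_contra hne
    have hle := minpoly.natDegree_le (A := F) (β ^ (1 + 2 * i))
    have hpos := minpoly.natDegree_pos (hint (β ^ (1 + 2 * i)))
    have := (hcoset i hi hqi i hi hqi _ (by omega)
      (pow_card_pow_natDegree_minpoly (F := F) (β ^ (1 + 2 * i)))).1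
    omega
  have hmonic : (∏ i ∈ S, minpoly F (β ^ (1 + 2 * i))).Monic :=
    monic_prod_of_monic _ _ fun i _ => minpoly.monic (hint _)
  have hdvd : ∀ i < δ - 1, minpoly F (β ^ (1 + 2 * i)) ∣ ∏ i ∈ S, minpoly F (β ^ (1 + 2 * i)) := by
    intro i
    induction i using Nat.strong_induction_on with
    | _ i ih =>
      intro hi
      by_cases hqi : q ∣ 1 + 2 * i
      · obtain ⟨c, hc⟩ := hqi
        obtain ⟨a, ha⟩ : Odd c := by
          have : Odd (q * c) := ⟨i, by omega⟩
          exact (Nat.odd_mul.mp this).2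
        have hlt : a < i := by nlinarith
        have := ih a hlt (by omega)
        rwa [hc, mul_comm, pow_mul, minpoly_pow_card, ha, add_comm]
      · exact Finset.dvd_prod_of_mem (fun i => minpoly F (β ^ (1 + 2 * i))) (hSmem.mpr ⟨hi, hqi⟩)
  have hgprod : g = ∏ i ∈ S, minpoly F (β ^ (1 + 2 * i)) := by
    rw [hg]
    refine dvd_antisymm_of_normalize_eq Finset.normalize_lcm hmonic.normalize_eq_self
      (Finset.lcm_dvd fun i hi => hdvd i (Finset.mem_range.mp hi)) ?_
    refine Finset.prod_dvd_of_coprime ?_ fun i hi =>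
      Finset.dvd_lcm (Finset.mem_range.mpr (hSmem.mp hi).1)
    intro i hi j hj hij
    obtain ⟨hi, hqi⟩ := hSmem.mp hi
    obtain ⟨hj, hqj⟩ := hSmem.mp hj
    refine ((minpoly.irreducible (hint _)).coprime_iff_not_dvd).mpr fun hd => hij ?_
    have heq := eq_of_monic_of_associated (minpoly.monic (hint _)) (minpoly.monic (hint _))
      ((minpoly.irreducible (hint _)).associated_of_dvd (minpoly.irreducible (hint _)) hd)
    obtain ⟨k, hk, he⟩ := exists_pow_card_pow_eq_of_minpoly_eq heq
    exact (hcoset i hi hqi j hj hqj k (hfin ▸ hk) he).2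
  refine ⟨hgprod, ?_, ?_⟩
  · rw [hgprod, natDegree_prod_of_monic _ _ fun i _ => minpoly.monic (hint _),
      Finset.sum_congr rfl hdegree, Finset.sum_const, smul_eq_mul, mul_comm]
    congr 1
    rw [hS, show (q - 1) / 2 = r by omega, hr, card_filter_range_not_mod_eq_ceil]
    congr 1
    obtain ⟨d, rfl⟩ := Nat.exists_eq_add_of_le hδ2
    rw [show 2 + d - 1 = d + 1 by omega, show 2 * (2 + d) - 3 = 2 * d + 1 by omega,
      show 2 * r + 1 - 1 = 2 * r by omega, show 2 * (2 * r + 1) - 1 = 4 * r + 1 by omega]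
    ring
  · intro c hc hgc hdeg
    have hroot : ∀ i < δ - 1, aeval (β ^ (1 + 2 * i)) c = 0 := fun i hi =>
      (minpoly.dvd_iff).mp (((hdvd i hi).trans hgprod.symm.dvd).trans hgc)
    split_ifs with hδq
    · have hq' : q ∣ 1 + 2 * (δ - 1) := by
        have h1 := Nat.div_add_mod δ q
        refine ⟨2 * (δ / q) + 1, ?_⟩
        have : q * (2 * (δ / q) + 1) = 2 * (q * (δ / q)) + q := by ring
        omega
      refine lt_card_support_of_aeval_odd_pow (T := δ) hβ hn2 hc hdeg fun i hi => ?_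
      rcases Nat.lt_or_ge i (δ - 1) with hlt | hge
      · exact hroot i hlt
      · obtain rfl : i = δ - 1 := by omega
        obtain ⟨s, hs⟩ := hq'
        obtain ⟨a, ha⟩ : Odd s := by
          have : Odd (q * s) := ⟨δ - 1, by omega⟩
          exact (Nat.odd_mul.mp this).2
        have hlt : a < δ - 1 := by nlinarith
        rw [hs, mul_comm, pow_mul, aeval_pow_card_eq, ha, add_comm (2 * a), hroot a hlt,
          zero_pow (by omega)]
    · have := lt_card_support_of_aeval_odd_pow (T := δ - 1) hβ hn2 hc hdeg hroot
      omega
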